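/- arXiv:1102.3530 — 3 statements merged into one kernel-verified Lean document; each statement's English description precedes it below -/
import Mathlib

section
/- Let u be a real number with 0 < u < log((3+√5)/2) and ξ := u + 2π√-1. Then Φ is complex-differentiable at every point of its domain with derivative dΦ/dw = log(1 - e^{u-ξw}) + log(1 - e^{u+ξw}) - u (principal logarithms) in a neighborhood of w₀ := (φ(u) + 2π√-1)/ξ, the point w₀ lies in the domain of Φ, and dΦ/dw(w₀) = 0; equivalently, e^{ξw₀} + e^{-ξw₀} = e^u + e^{-u} - 1. -/
open Complex MeasureTheory Filter Topology Finset

noncomputable section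

/-- The dilogarithm `Li₂(z) = -∫₀^z log(1-x)/x dx` along the segment from `0` to `z`. -/
def dilog (z : ℂ) : ℂ := -∫ t in (0:ℝ)..1, Complex.log (1 - (t:ℂ) * z) / (t:ℂ)

/-- Colored Jones polynomial of the figure-eight knot (Habiro–Le formula). -/
def JE (N : ℕ) (q : ℂ) : ℂ :=
  ∑ k ∈ Finset.range N, ∏ l ∈ Finset.Icc 1 k,
    ((q ^ (((N:ℂ) - (l:ℂ))/2) - q ^ (-(((N:ℂ) - (l:ℂ))/2))) *
     (q ^ (((N:ℂ) + (l:ℂ))/2) - q ^ (-(((N:ℂ) + (l:ℂ))/2))))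

/-- Integral over the contour `C_R = (-∞,-R] ∪ Ω_R ∪ [R,∞)`, where `Ω_R` is the upper
semicircle of radius `R` traversed from `-R` to `R`. -/
def contourCR (R : ℝ) (f : ℂ → ℂ) : ℂ :=
  (∫ t in Set.Iic (-R), f (t:ℂ)) +
  (∫ s in (0:ℝ)..Real.pi,
      f ((R:ℂ) * Complex.exp (Complex.I * ((Real.pi:ℂ) - (s:ℂ)))) *
        (-Complex.I * (R:ℂ) * Complex.exp (Complex.I * ((Real.pi:ℂ) - (s:ℂ))))) +
  (∫ t in Set.Ici R, f (t:ℂ))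

/-- Faddeev's quantum dilogarithm `S_γ(z)`. -/
def Sqd (γ : ℂ) (R : ℝ) (z : ℂ) : ℂ :=
  Complex.exp ((1/4) * contourCR R
    (fun t => Complex.exp (z * t) / (Complex.sinh ((Real.pi:ℂ) * t) * Complex.sinh (γ * t) * t)))

/-- The square root of `(e^u+e^{-u}+1)(e^u+e^{-u}-3)` chosen as a positive multiple of `√-1`. -/
def betaRoot (u : ℝ) : ℂ :=
  Complex.I * (Real.sqrt (-((Real.exp u + Real.exp (-u) + 1) * (Real.exp u + Real.exp (-u) - 3))) : ℝ)

/-- `φ(u) = arccosh(cosh u - 1/2)` with the branch described in the paper. -/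
def phiu (u : ℝ) : ℂ :=
  Complex.log (((Real.exp u + Real.exp (-u) - 1 : ℝ) - betaRoot u) / 2)

/-- `S(u) = Li₂(e^{u-φ(u)}) - Li₂(e^{u+φ(u)}) - uφ(u)`. -/
def Su (u : ℝ) : ℂ :=
  dilog (Complex.exp ((u:ℂ) - phiu u)) - dilog (Complex.exp ((u:ℂ) + phiu u)) - (u:ℂ) * phiu u

/-- `Φ(w) = (1/ξ)(Li₂(e^{u-ξw}) - Li₂(e^{u+ξw})) - uw` with `ξ = u + 2π√-1`. -/
def Phi (u : ℝ) (w : ℂ) : ℂ :=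
  (1/((u:ℂ) + 2*(Real.pi:ℂ)*Complex.I)) *
    (dilog (Complex.exp ((u:ℂ) - ((u:ℂ) + 2*(Real.pi:ℂ)*Complex.I) * w)) -
     dilog (Complex.exp ((u:ℂ) + ((u:ℂ) + 2*(Real.pi:ℂ)*Complex.I) * w))) - (u:ℂ) * w

/-- `g_N(w) = e^{-Nuw} S_γ(π-√-1u+√-1ξw)/S_γ(-π-√-1u-√-1ξw)`, `γ = (2π-√-1u)/(2N)`. -/
def gN (u : ℝ) (N : ℕ) (R : ℝ) (w : ℂ) : ℂ :=
  Complex.exp (-(N:ℂ) * (u:ℂ) * w) *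
    Sqd ((2*(Real.pi:ℂ) - Complex.I*(u:ℂ))/(2*(N:ℂ))) R
      ((Real.pi:ℂ) - Complex.I*(u:ℂ) + Complex.I*((u:ℂ) + 2*(Real.pi:ℂ)*Complex.I)*w) /
    Sqd ((2*(Real.pi:ℂ) - Complex.I*(u:ℂ))/(2*(N:ℂ))) R
      (-(Real.pi:ℂ) - Complex.I*(u:ℂ) - Complex.I*((u:ℂ) + 2*(Real.pi:ℂ)*Complex.I)*w)

/-- Integral of `f` along the straight segment from `a` to `b`. -/
def segInt (f : ℂ → ℂ) (a b : ℂ) : ℂ :=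
  ∫ t in (0:ℝ)..1, f (a + (t:ℂ) * (b - a)) * (b - a)

/-- Integral of `f` along the polygonal line through the given list of vertices. -/
def polyInt (f : ℂ → ℂ) : List ℂ → ℂ
  | a :: b :: rest => segInt f a b + polyInt f (b :: rest)
  | _ => 0

/-- Vertices of the polygonal line `C_+(ε)`. -/
def Cplus (u ε : ℝ) : List ℂ :=
  [((1 - ε : ℝ) : ℂ),
   ((1 - u/(2*Real.pi) - ε : ℝ) : ℂ) + Complex.I,
   ((-(u/(2*Real.pi)) + ε : ℝ) : ℂ) + Complex.I,
   ((ε : ℝ) : ℂ)]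

/-- Vertices of the polygonal line `C_-(ε)`. -/
def Cminus (u ε : ℝ) : List ℂ :=
  [((ε : ℝ) : ℂ),
   ((u/(2*Real.pi) : ℝ) : ℂ) - Complex.I,
   ((1 + u/(2*Real.pi) : ℝ) : ℂ) - Complex.I,
   ((1 - ε : ℝ) : ℂ)]

/-- `I_γ(z)` from Andersen–Hansen. -/
def Iqd (γ : ℂ) (R : ℝ) (z : ℂ) : ℂ :=
  (1/4) * contourCR R
    (fun t => Complex.exp (z * t) / (t * Complex.sinh ((Real.pi:ℂ) * t)) *
      (1/Complex.sinh (γ * t) - 1/(γ * t)))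

end

/-- The complement of the cut `[1, ∞)` is star-shaped about `0`. -/
theorem one_sub_smul_mem_slitPlane {z : ℂ} (hz : 1 - z ∈ slitPlane) {t : ℝ}
    (ht : t ∈ Set.Icc (0 : ℝ) 1) : 1 - (t : ℂ) * z ∈ slitPlane := by
  rw [mem_slitPlane_iff] at hz ⊢
  simp only [sub_re, sub_im, one_re, one_im, mul_re, mul_im, ofReal_re, ofReal_im, zero_mul,
    sub_zero, add_zero, zero_sub, neg_ne_zero] at hz ⊢
  rcases ht.1.eq_or_lt with rfl | h0
  · simp
  · rcases hz with h | h
    · left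
      nlinarith [ht.2]
    · exact Or.inr (mul_ne_zero h0.ne' h)

theorem hasDerivAt_log_one_sub_ofReal_mul {z : ℂ} {t : ℝ} (h : 1 - (t : ℂ) * z ∈ slitPlane) :
    HasDerivAt (fun s : ℝ => Complex.log (1 - (s : ℂ) * z)) (-z / (1 - (t : ℂ) * z)) t := by
  have h1 : HasDerivAt (fun s : ℝ => 1 - (s : ℂ) * z) (-z) t := by
    simpa using ((hasDerivAt_id t).ofReal_comp.mul_const z).const_sub 1
  exact h1.clog_real h

theorem intervalIntegrable_dilog {z : ℂ} (hz : 1 - z ∈ slitPlane) :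
    IntervalIntegrable (fun t : ℝ => Complex.log (1 - (t : ℂ) * z) / (t : ℂ)) volume 0 1 := by
  set f : ℝ → ℂ := fun s => Complex.log (1 - (s : ℂ) * z)
  set s : Set ℝ := (fun t : ℝ => 1 - (t : ℂ) * z) ⁻¹' slitPlane
  have hs : s ∈ 𝓝 (0 : ℝ) :=
    (isOpen_slitPlane.preimage (by fun_prop)).mem_nhds (by simp)
  have hd : ∀ t ∈ s, DifferentiableAt ℝ f t := fun t ht =>
    (hasDerivAt_log_one_sub_ofReal_mul ht).differentiableAt
  have hc : ContinuousOn (dslope f 0) s :=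
    (continuousOn_dslope hs).2
      ⟨fun t ht => (hd t ht).continuousAt.continuousWithinAt, hd 0 (mem_of_mem_nhds hs)⟩
  have hi : IntervalIntegrable (dslope f 0) volume 0 1 := by
    apply ContinuousOn.intervalIntegrable
    rw [Set.uIcc_of_le zero_le_one]
    exact hc.mono fun t ht => one_sub_smul_mem_slitPlane hz ht
  refine hi.congr fun t ht => ?_
  rw [Set.uIoc_of_le zero_le_one] at ht
  simp only [dslope_of_ne _ ht.1.ne', slope_def_module, f]
  simp [div_eq_inv_mul]

theorem hasDerivAt_dilog {z : ℂ} (hz : 1 - z ∈ slitPlane) (hz0 : z ≠ 0) :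
    HasDerivAt dilog (-(Complex.log (1 - z) / z)) z := by
  have hU : IsOpen {w : ℂ | 1 - w ∈ slitPlane} := isOpen_slitPlane.preimage (by fun_prop)
  obtain ⟨r, hr, hball⟩ := Metric.nhds_basis_closedBall.mem_iff.1 (hU.mem_nhds hz)
  have hK : IsCompact (Set.Icc (0 : ℝ) 1 ×ˢ Metric.closedBall z r) :=
    isCompact_Icc.prod (isCompact_closedBall z r)
  have hcont : ContinuousOn (fun p : ℝ × ℂ => -1 / (1 - (p.1 : ℂ) * p.2))
      (Set.Icc (0 : ℝ) 1 ×ˢ Metric.closedBall z r) := by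
    refine ContinuousOn.div (by fun_prop) (by fun_prop) fun p hp => ?_
    exact slitPlane_ne_zero (one_sub_smul_mem_slitPlane (hball hp.2) hp.1)
  obtain ⟨C, hC⟩ := hK.exists_bound_of_continuousOn hcont
  have key := intervalIntegral.hasDerivAt_integral_of_dominated_loc_of_deriv_le
    (μ := volume) (a := 0) (b := 1) (bound := fun _ => C) (s := Metric.closedBall z r)
    (F := fun (w : ℂ) (t : ℝ) => Complex.log (1 - (t : ℂ) * w) / (t : ℂ))
    (F' := fun (w : ℂ) (t : ℝ) => -1 / (1 - (t : ℂ) * w)) (x₀ := z)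
    (Metric.closedBall_mem_nhds z hr)
    (Eventually.of_forall fun w => by
      apply Measurable.aestronglyMeasurable
      fun_prop)
    (intervalIntegrable_dilog hz)
    (by
      apply Measurable.aestronglyMeasurable
      fun_prop)
    (ae_of_all _ fun t ht w hw => by
      rw [Set.uIoc_of_le zero_le_one] at ht
      exact hC (t, w) ⟨Set.Ioc_subset_Icc_self ht, hw⟩)
    intervalIntegrable_const
    (ae_of_all _ fun t ht w hw => by
      rw [Set.uIoc_of_le zero_le_one] at ht
      have hm := one_sub_smul_mem_slitPlane (hball hw) (Set.Ioc_subset_Icc_self ht)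
      have ht0 : (t : ℂ) ≠ 0 := ofReal_ne_zero.2 ht.1.ne'
      have h1 : HasDerivAt (fun x : ℂ => 1 - (t : ℂ) * x) (-(t : ℂ)) w := by
        simpa using ((hasDerivAt_id w).const_mul (t : ℂ)).const_sub 1
      refine ((h1.clog hm).div_const (t : ℂ)).congr_deriv ?_
      have := slitPlane_ne_zero hm
      field_simp)
  have hint : ∫ t in (0:ℝ)..1, -1 / (1 - (t : ℂ) * z) = Complex.log (1 - z) / z := by
    rw [intervalIntegral.integral_eq_sub_of_hasDerivAt
      (f := fun t : ℝ => Complex.log (1 - (t : ℂ) * z) / z)]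
    · simp
    · intro t ht
      rw [Set.uIcc_of_le zero_le_one] at ht
      have hm := one_sub_smul_mem_slitPlane hz ht
      refine ((hasDerivAt_log_one_sub_ofReal_mul hm).div_const z).congr_deriv ?_
      have := slitPlane_ne_zero hm
      field_simp
    · apply ContinuousOn.intervalIntegrable
      rw [Set.uIcc_of_le zero_le_one]
      exact hcont.comp (f := fun t : ℝ => (t, z)) (by fun_prop)
        fun t ht => ⟨ht, Metric.mem_closedBall_self hr.le⟩
  rw [← hint]
  exact key.2.neg

/-- Off the lines `Im z ∈ 2πℤ`, the exponential avoids the cut of the dilogarithm. -/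
theorem one_sub_exp_mem_slitPlane {z : ℂ} (hz : 0 < z.im) (hz' : z.im < 2 * Real.pi) :
    1 - Complex.exp z ∈ slitPlane := by
  rw [mem_slitPlane_iff]
  by_contra! h
  simp only [sub_re, sub_im, one_re, one_im, exp_re, exp_im, zero_sub, neg_eq_zero,
    mul_eq_zero, (Real.exp_pos _).ne', false_or] at h
  have h1 : Real.sin (z.im - Real.pi) = 0 := by simp [Real.sin_sub_pi, h.2]
  have h2 : z.im - Real.pi = 0 :=
    (Real.sin_eq_zero_iff_of_lt_of_lt (by linarith) (by linarith)).1 h1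
  rw [sub_eq_zero.1 h2, Real.cos_pi] at h
  linarith [h.1, Real.exp_pos z.re]

theorem one_sub_exp_mem_slitPlane_of_neg {z : ℂ} (hz : z.im < 0) (hz' : -(2 * Real.pi) < z.im) :
    1 - Complex.exp z ∈ slitPlane := by
  rw [← Complex.exp_periodic z]
  refine one_sub_exp_mem_slitPlane ?_ ?_ <;> simp <;> linarith

theorem mem_strip_iff {u : ℝ} (hu : 0 < u) (w : ℂ) :
    (-(2*Real.pi/u) * w.re < w.im ∧ w.im < -(2*Real.pi/u) * (w.re - 1)) ↔
      0 < (((u:ℂ) + 2*(Real.pi:ℂ)*Complex.I) * w).im ∧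
        (((u:ℂ) + 2*(Real.pi:ℂ)*Complex.I) * w).im < 2 * Real.pi := by
  have him : (((u:ℂ) + 2*(Real.pi:ℂ)*Complex.I) * w).im = u * w.im + 2 * Real.pi * w.re := by
    simp
  have e1 : -(2*Real.pi/u) * w.re = -(2 * Real.pi * w.re) / u := by ring
  have e2 : -(2*Real.pi/u) * (w.re - 1) = -(2 * Real.pi * (w.re - 1)) / u := by ring
  rw [him, e1, e2, div_lt_iff₀ hu, lt_div_iff₀ hu]
  constructor <;> rintro ⟨h1, h2⟩ <;> constructor <;> linarith

theorem hasDerivAt_Phi {u : ℝ} {ξ w : ℂ} (hξ : ξ = (u:ℂ) + 2*(Real.pi:ℂ)*Complex.I)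
    (h0 : 0 < (ξ * w).im) (h1 : (ξ * w).im < 2 * Real.pi) :
    HasDerivAt (Phi u) (Complex.log (1 - Complex.exp ((u:ℂ) - ξ*w)) +
      Complex.log (1 - Complex.exp ((u:ℂ) + ξ*w)) - (u:ℂ)) w := by
  have hξ0 : ξ ≠ 0 := by
    rintro rfl
    simp at h0
  have hm : HasDerivAt (fun w : ℂ => Complex.exp ((u:ℂ) - ξ * w))
      (Complex.exp ((u:ℂ) - ξ * w) * -ξ) w := by
    simpa using (((hasDerivAt_id w).const_mul ξ).const_sub (u:ℂ)).cexp
  have hp : HasDerivAt (fun w : ℂ => Complex.exp ((u:ℂ) + ξ * w))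
      (Complex.exp ((u:ℂ) + ξ * w) * ξ) w := by
    simpa using (((hasDerivAt_id w).const_mul ξ).const_add (u:ℂ)).cexp
  have sm : 1 - Complex.exp ((u:ℂ) - ξ * w) ∈ slitPlane :=
    one_sub_exp_mem_slitPlane_of_neg
      (by rw [sub_im, ofReal_im]; linarith) (by rw [sub_im, ofReal_im]; linarith)
  have sp : 1 - Complex.exp ((u:ℂ) + ξ * w) ∈ slitPlane :=
    one_sub_exp_mem_slitPlane (by simpa using h0) (by simpa using h1)
  have dm := (hasDerivAt_dilog sm (Complex.exp_ne_zero _)).comp w hm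
  have dp := (hasDerivAt_dilog sp (Complex.exp_ne_zero _)).comp w hp
  have key := ((dm.sub dp).const_mul (1 / ξ)).sub ((hasDerivAt_id w).const_mul (u:ℂ))
  have hPhi : Phi u = fun w => 1 / ξ * (dilog (Complex.exp ((u:ℂ) - ξ * w)) -
      dilog (Complex.exp ((u:ℂ) + ξ * w))) - (u:ℂ) * w := by
    subst hξ
    rfl
  rw [hPhi]
  refine key.congr_deriv ?_
  have em := Complex.exp_ne_zero ((u:ℂ) - ξ * w)
  have ep := Complex.exp_ne_zero ((u:ℂ) + ξ * w)
  field_simp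
  ring

theorem exp_add_exp_neg_lt_three {u : ℝ} (hu0 : 0 < u)
    (hu1 : u < Real.log ((3 + Real.sqrt 5)/2)) : Real.exp u + Real.exp (-u) < 3 := by
  have h5 : Real.sqrt 5 ^ 2 = 5 := Real.sq_sqrt (by norm_num)
  have h5' : 0 ≤ Real.sqrt 5 := Real.sqrt_nonneg 5
  have hx : Real.exp u < (3 + Real.sqrt 5)/2 := (Real.lt_log_iff_exp_lt (by positivity)).1 hu1
  have hx1 : 1 < Real.exp u := Real.one_lt_exp_iff.2 hu0
  rw [Real.exp_neg, ← sub_pos]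
  have : 3 - (Real.exp u + (Real.exp u)⁻¹) =
      (3 * Real.exp u - Real.exp u ^ 2 - 1) / Real.exp u := by
    field_simp
    ring
  rw [this]
  apply div_pos _ (Real.exp_pos u)
  nlinarith [mul_pos (sub_pos.2 hx) (show 0 < Real.exp u - (3 - Real.sqrt 5)/2 by nlinarith)]

/-- `φ(u)` is purely imaginary with negative imaginary part, and `2 cosh φ(u) = 2 cosh u - 1`. -/
theorem phiu_spec {u : ℝ} (hu0 : 0 < u) (hu1 : u < Real.log ((3 + Real.sqrt 5)/2)) :
    (phiu u).re = 0 ∧ (phiu u).im < 0 ∧ Complex.exp (phiu u) + Complex.exp (-phiu u) =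
      Complex.exp (u:ℂ) + Complex.exp (-(u:ℂ)) - 1 := by
  have ha := exp_add_exp_neg_lt_three hu0 hu1
  set a : ℝ := Real.exp u + Real.exp (-u) with ha_def
  have ha0 : 0 < a := by positivity
  set b : ℝ := Real.sqrt (-((a + 1) * (a - 3))) with hb_def
  have hpos : 0 < -((a + 1) * (a - 3)) := by nlinarith
  have hb : 0 < b := Real.sqrt_pos.2 hpos
  have hb2 : b ^ 2 = -((a + 1) * (a - 3)) := Real.sq_sqrt hpos.le
  set z : ℂ := ⟨(a - 1) / 2, -b / 2⟩
  have hphi : phiu u = Complex.log z := by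
    rw [phiu, betaRoot]
    congr 1
    apply Complex.ext
    · simp [-ofReal_exp, z, ha_def]
    · simp [-ofReal_exp, z, ha_def, hb_def]
  have hn : Complex.normSq z = 1 := by
    rw [normSq_mk]
    linear_combination hb2 / 4
  have hz0 : z ≠ 0 := by
    intro h
    simp [h] at hn
  have hinv : z⁻¹ = (starRingEnd ℂ) z := by simp [Complex.inv_def, hn]
  refine ⟨?_, ?_, ?_⟩
  · rw [hphi, Complex.log_re, Complex.norm_def, hn]
    simp
  · rw [hphi, Complex.log_im, Complex.arg_neg_iff]
    exact div_neg_of_neg_of_pos (neg_lt_zero.2 hb) two_pos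
  · rw [hphi, Complex.exp_neg, Complex.exp_log hz0, hinv, Complex.add_conj]
    simp only [z, ha_def]
    push_cast
    ring

theorem log_add_log_conj {v : ℂ} (hv : v ∈ slitPlane) :
    Complex.log v + Complex.log ((starRingEnd ℂ) v) = Real.log (Complex.normSq v) := by
  rw [Complex.log_conj _ (mem_slitPlane_iff_arg.1 hv).1, Complex.add_conj, Complex.log_re,
    Complex.normSq_eq_norm_sq, Real.log_pow]
  push_cast
  ring

/-- `Φ` is complex-differentiable on its domain, its derivative near
`w₀` is `log(1-e^{u-ξw}) + log(1-e^{u+ξw}) - u`, the point `w₀` lies in the domain,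
`Φ'(w₀) = 0`, and `e^{ξw₀} + e^{-ξw₀} = e^u + e^{-u} - 1`. -/
theorem stmt9 (u : ℝ) (hu0 : 0 < u) (hu1 : u < Real.log ((3 + Real.sqrt 5)/2))
    (ξ w₀ : ℂ) (hξ : ξ = (u:ℂ) + 2*(Real.pi:ℂ)*Complex.I)
    (hw : w₀ = (phiu u + 2*(Real.pi:ℂ)*Complex.I)/ξ) :
    (∀ w : ℂ, -(2*Real.pi/u) * w.re < w.im → w.im < -(2*Real.pi/u) * (w.re - 1) →
      DifferentiableAt ℂ (Phi u) w) ∧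
    (∀ᶠ w in nhds w₀,
      HasDerivAt (Phi u)
        (Complex.log (1 - Complex.exp ((u:ℂ) - ξ*w)) +
         Complex.log (1 - Complex.exp ((u:ℂ) + ξ*w)) - (u:ℂ)) w) ∧
    (-(2*Real.pi/u) * w₀.re < w₀.im ∧ w₀.im < -(2*Real.pi/u) * (w₀.re - 1)) ∧
    HasDerivAt (Phi u) 0 w₀ ∧
    Complex.exp (ξ*w₀) + Complex.exp (-(ξ*w₀)) =
      Complex.exp (u:ℂ) + Complex.exp (-(u:ℂ)) - 1 := by
  have hξ0 : ξ ≠ 0 := by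
    intro h
    have := congrArg Complex.re (hξ.symm.trans h)
    simp [hu0.ne'] at this
  obtain ⟨hre, him, hcosh⟩ := phiu_spec hu0 hu1
  have hξw : ξ * w₀ = phiu u + 2*(Real.pi:ℂ)*Complex.I := by
    rw [hw]
    field_simp
  have hexp : Complex.exp (ξ * w₀) = Complex.exp (phiu u) := by
    rw [hξw, Complex.exp_periodic]
  have hsum : Complex.exp (ξ*w₀) + Complex.exp (-(ξ*w₀)) =
      Complex.exp (u:ℂ) + Complex.exp (-(u:ℂ)) - 1 := by
    rw [Complex.exp_neg (ξ * w₀), hexp, ← Complex.exp_neg, hcosh]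
  have him0 : 0 < (ξ * w₀).im := by
    have hlow : -Real.pi < (phiu u).im := Complex.neg_pi_lt_log_im _
    simp [hξw]
    linarith [Real.pi_pos]
  have him1 : (ξ * w₀).im < 2 * Real.pi := by
    simp [hξw]
    linarith
  have hnear : ∀ᶠ w in nhds w₀, 0 < (ξ * w).im ∧ (ξ * w).im < 2 * Real.pi := by
    have hc : ContinuousAt (fun w : ℂ => (ξ * w).im) w₀ := by fun_prop
    exact (hc.eventually (lt_mem_nhds him0)).and (hc.eventually (gt_mem_nhds him1))
  refine ⟨fun w h0 h1 => ?_, hnear.mono fun w h => hasDerivAt_Phi hξ h.1 h.2,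
    (mem_strip_iff hu0 w₀).2 (hξ ▸ ⟨him0, him1⟩), ?_, hsum⟩
  · have h := (mem_strip_iff hu0 w).1 ⟨h0, h1⟩
    exact (hasDerivAt_Phi rfl h.1 h.2).differentiableAt
  · refine (hasDerivAt_Phi hξ him0 him1).congr_deriv ?_
    have hconj : (starRingEnd ℂ) (ξ * w₀) = -(ξ * w₀) := by
      rw [hξw]
      apply Complex.ext <;> simp [hre, add_comm]
    have hv : 1 - Complex.exp ((u:ℂ) - ξ * w₀) =
        (starRingEnd ℂ) (1 - Complex.exp ((u:ℂ) + ξ * w₀)) := by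
      rw [map_sub, map_one, ← Complex.exp_conj, map_add, hconj, Complex.conj_ofReal,
        sub_eq_add_neg (u:ℂ)]
    have hs : 1 - Complex.exp ((u:ℂ) + ξ * w₀) ∈ slitPlane :=
      one_sub_exp_mem_slitPlane (by simpa using him0) (by simpa using him1)
    have hnorm : Complex.normSq (1 - Complex.exp ((u:ℂ) + ξ * w₀)) = Real.exp u := by
      apply Complex.ofReal_injective
      rw [Complex.normSq_eq_conj_mul_self, ← hv, sub_eq_add_neg (u:ℂ), Complex.exp_add,
        Complex.exp_add, Complex.ofReal_exp]
      have e1 : Complex.exp (ξ * w₀) * Complex.exp (-(ξ * w₀)) = 1 := by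
        rw [← Complex.exp_add]
        simp
      have e2 : Complex.exp (u:ℂ) * Complex.exp (-(u:ℂ)) = 1 := by
        rw [← Complex.exp_add]
        simp
      linear_combination Complex.exp (u:ℂ) ^ 2 * e1 - Complex.exp (u:ℂ) * hsum - e2
    rw [hv, add_comm (Complex.log _), log_add_log_conj hs, hnorm, Real.log_exp, sub_self]
end

section
/- For every real r with 0 < r < 1 and every real θ with 0 < θ < 2π, the real part of the dilogarithm satisfies -π²/12 ≤ Re Li₂(r e^{√-1 θ}) ≤ π²/6. Equivalently, -π²/12 ≤ -(1/2)∫₀^r log(1 - 2s cos θ + s²)/s ds ≤ π²/6. -/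
open Complex MeasureTheory Filter Topology Finset

/-- The integrand of `dilog` is integrable on `[0, 1]` when `‖z‖ < 1`. -/
lemma intervalIntegrable_log_one_sub_mul_div {z : ℂ} (hz : ‖z‖ < 1) :
    IntervalIntegrable (fun t : ℝ => Complex.log (1 - (t:ℂ) * z) / (t:ℂ)) volume 0 1 := by
  refine (intervalIntegrable_const (c := (1 - ‖z‖)⁻¹ + 1)).mono_fun'
    (Measurable.aestronglyMeasurable (by fun_prop)) ?_
  refine (ae_restrict_iff' measurableSet_uIoc).2 (Eventually.of_forall fun t ht => ?_)
  rw [Set.uIoc_of_le zero_le_one] at ht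
  obtain ⟨ht0, ht1⟩ := ht
  have hn : ‖-((t:ℂ) * z)‖ = t * ‖z‖ := by simp [abs_of_pos ht0]
  have hle : t * ‖z‖ ≤ ‖z‖ := mul_le_of_le_one_left (norm_nonneg z) ht1
  have hlog := Complex.norm_log_one_add_le (z := -((t:ℂ) * z)) (by rw [hn]; linarith)
  rw [hn, ← sub_eq_add_neg] at hlog
  change ‖Complex.log (1 - (t:ℂ) * z) / (t:ℂ)‖ ≤ (1 - ‖z‖)⁻¹ + 1
  rw [norm_div, Complex.norm_real, Real.norm_of_nonneg ht0.le, div_le_iff₀ ht0]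
  have hinv : (1 - t * ‖z‖)⁻¹ ≤ (1 - ‖z‖)⁻¹ := inv_anti₀ (by linarith) (by linarith)
  have hpos : 0 ≤ (1 - ‖z‖)⁻¹ := inv_nonneg.2 (by linarith)
  have hsq : (t * ‖z‖) ^ 2 ≤ t := by
    have : 0 ≤ t * ‖z‖ := by positivity
    nlinarith [norm_nonneg z]
  have hmul : (t * ‖z‖) ^ 2 * (1 - t * ‖z‖)⁻¹ ≤ t * (1 - ‖z‖)⁻¹ :=
    mul_le_mul hsq hinv (inv_nonneg.2 (by linarith)) ht0.le
  nlinarith [mul_nonneg ht0.le hpos]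

/-- The power series of the dilogarithm on the open unit disc. -/
lemma hasSum_dilog {z : ℂ} (hz : ‖z‖ < 1) :
    HasSum (fun n : ℕ => z ^ n / (n:ℂ) ^ 2) (dilog z) := by
  have key : HasSum (fun n : ℕ => ∫ t in (0:ℝ)..1, z ^ (n + 1) / ((n:ℂ) + 1) * (t:ℂ) ^ n)
      (∫ t in (0:ℝ)..1, -(Complex.log (1 - (t:ℂ) * z) / (t:ℂ))) := by
    refine intervalIntegral.hasSum_integral_of_dominated_convergence (fun n _ => ‖z‖ ^ n)
      (fun n => by fun_prop) (fun n => Eventually.of_forall fun t ht => ?_)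
      (Eventually.of_forall fun t _ => summable_geometric_of_lt_one (norm_nonneg z) hz)
      intervalIntegrable_const (Eventually.of_forall fun t ht => ?_)
    · rw [Set.uIoc_of_le zero_le_one] at ht
      have hn : ‖(n:ℂ) + 1‖ = (n:ℝ) + 1 := by
        rw [← Nat.cast_succ, Complex.norm_natCast, Nat.cast_succ]
      rw [norm_mul, norm_div, norm_pow, norm_pow, hn, Complex.norm_real,
        Real.norm_of_nonneg ht.1.le]
      have h1 : ‖z‖ ^ (n + 1) / ((n:ℝ) + 1) ≤ ‖z‖ ^ n := by
        refine (div_le_self (by positivity) (by simp)).trans ?_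
        exact pow_le_pow_of_le_one (norm_nonneg z) hz.le n.le_succ
      exact (mul_le_of_le_one_right (by positivity) (pow_le_one₀ ht.1.le ht.2)).trans h1
    · rw [Set.uIoc_of_le zero_le_one] at ht
      have ht0 : (t:ℂ) ≠ 0 := Complex.ofReal_ne_zero.2 ht.1.ne'
      have hn : ‖(t:ℂ) * z‖ < 1 := by
        rw [norm_mul, Complex.norm_real, Real.norm_of_nonneg ht.1.le]
        exact (mul_le_of_le_one_left (norm_nonneg z) ht.2).trans_lt hz
      convert! (Complex.hasSum_taylorSeries_neg_log' hn).div_const (t:ℂ) using 1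
      · funext n
        field_simp
        ring
      · rw [neg_div]
  rw [intervalIntegral.integral_neg, ← dilog] at key
  rw [← hasSum_nat_add_iff' 1]
  convert! key using 1
  · funext n
    rw [intervalIntegral.integral_const_mul]
    have : ∫ t in (0:ℝ)..1, (t:ℂ) ^ n = 1 / ((n:ℂ) + 1) := by
      have h := integral_pow (a := 0) (b := 1) n
      have h' := congrArg (fun x : ℝ => (x:ℂ)) h
      simp only [← intervalIntegral.integral_ofReal] at h'
      push_cast at h'
      rw [h']
      simp
    rw [this]
    push_cast
    field_simp
  · simp

lemma re_dilog_eq_neg_integral {z : ℂ} (hz : ‖z‖ < 1) :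
    (dilog z).re = -∫ t in (0:ℝ)..1, Real.log ‖1 - (t:ℂ) * z‖ / t := by
  have h := Complex.reCLM.intervalIntegral_comp_comm (intervalIntegrable_log_one_sub_mul_div hz)
  simp only [Complex.reCLM_apply, Complex.div_ofReal_re, Complex.log_re] at h
  rw [dilog, Complex.neg_re, h]

lemma re_dilog_neg_le {z : ℂ} {ρ : ℝ} (hz : ‖z‖ ≤ ρ) (hρ : ρ < 1) :
    (dilog (-(ρ:ℂ))).re ≤ (dilog z).re := by
  have hρ0 : 0 ≤ ρ := (norm_nonneg z).trans hz
  have hn : ‖(-(ρ:ℂ))‖ < 1 := by simpa [abs_of_nonneg hρ0] using hρ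
  have hint : ∀ {w : ℂ}, ‖w‖ < 1 →
      IntervalIntegrable (fun t : ℝ => Real.log ‖1 - (t:ℂ) * w‖ / t) volume 0 1 := by
    intro w hw
    have h := intervalIntegrable_log_one_sub_mul_div hw
    have h' : IntervalIntegrable
        (fun t : ℝ => (Complex.log (1 - (t:ℂ) * w) / (t:ℂ)).re) volume 0 1 :=
      ⟨h.1.re, h.2.re⟩
    simpa only [Complex.div_ofReal_re, Complex.log_re] using h'
  have hz1 := hz.trans_lt hρ
  rw [re_dilog_eq_neg_integral hn, re_dilog_eq_neg_integral hz1, neg_le_neg_iff]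
  refine intervalIntegral.integral_mono_on zero_le_one (hint hz1) (hint hn) fun t ht => ?_
  have htz : ‖(t:ℂ) * z‖ ≤ t * ρ := by
    rw [norm_mul, Complex.norm_real, Real.norm_of_nonneg ht.1]
    exact mul_le_mul_of_nonneg_left hz ht.1
  have htρ : t * ρ < 1 := (mul_le_of_le_one_left hρ0 ht.2).trans_lt hρ
  have hr : ‖1 - (t:ℂ) * -(ρ:ℂ)‖ = 1 + t * ρ := by
    have : 1 - (t:ℂ) * -(ρ:ℂ) = ((1 + t * ρ : ℝ) : ℂ) := by push_cast; ring
    rw [this, Complex.norm_real, Real.norm_of_nonneg]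
    have := mul_nonneg ht.1 hρ0
    linarith
  refine div_le_div_of_nonneg_right (Real.log_le_log ?_ ?_) ht.1
  · have := norm_sub_norm_le (1:ℂ) ((t:ℂ) * z)
    rw [norm_one] at this
    linarith
  · rw [hr]
    have := norm_sub_le (1:ℂ) ((t:ℂ) * z)
    rw [norm_one] at this
    linarith

lemma hasSum_neg_one_pow_div_sq :
    HasSum (fun n : ℕ => (-1:ℝ) ^ n / (n:ℝ) ^ 2) (-Real.pi ^ 2 / 12) := by
  convert! hasSum_one_div_nat_pow_mul_cos one_ne_zero (x := 1 / 2) ⟨by norm_num, by norm_num⟩ using 1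
  · funext n
    rw [show 2 * Real.pi * (n:ℝ) * (1 / 2) = n * Real.pi by ring, Real.cos_nat_mul_pi]
    ring
  · have hB : (Polynomial.map (algebraMap ℚ ℝ) (Polynomial.bernoulli (2 * 1))).eval (1 / 2)
        = -1 / 12 := by
      norm_num [Polynomial.bernoulli, Finset.sum_range_succ, Nat.choose, bernoulli_one]
    rw [hB]
    norm_num [Nat.factorial]
    ring

lemma tendsto_re_dilog_neg :
    Tendsto (fun ρ : ℝ => (dilog (-(ρ:ℂ))).re) (𝓝[<] 1) (𝓝 (-Real.pi ^ 2 / 12)) := by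
  have hcont : ContinuousOn (fun ρ : ℝ => ∑' n : ℕ, (-ρ) ^ n / (n:ℝ) ^ 2) (Set.Icc 0 1) := by
    refine continuousOn_tsum (fun n => by fun_prop) hasSum_zeta_two.summable fun n ρ hρ => ?_
    rw [norm_div, norm_pow, norm_neg, Real.norm_of_nonneg hρ.1,
      Real.norm_of_nonneg (by positivity : (0:ℝ) ≤ (n:ℝ) ^ 2)]
    exact div_le_div_of_nonneg_right (pow_le_one₀ hρ.1 hρ.2) (by positivity)
  have hlim := (hcont 1 ⟨zero_le_one, le_rfl⟩).tendsto
  rw [hasSum_neg_one_pow_div_sq.tsum_eq] at hlim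
  have hIco : Set.Ico (0:ℝ) 1 ∈ 𝓝[<] (1:ℝ) := Ico_mem_nhdsLT zero_lt_one
  have hle : 𝓝[<] (1:ℝ) ≤ 𝓝[Set.Icc 0 1] 1 :=
    nhdsWithin_le_of_mem (mem_of_superset hIco Set.Ico_subset_Icc_self)
  refine (hlim.mono_left hle).congr' ?_
  filter_upwards [hIco] with ρ hρ
  have h := Complex.hasSum_re (hasSum_dilog (z := -(ρ:ℂ)) (by simpa [abs_of_nonneg hρ.1] using hρ.2))
  rw [← h.tsum_eq]
  refine tsum_congr fun n => ?_
  have : (-(ρ:ℂ)) ^ n / (n:ℂ) ^ 2 = (((-ρ) ^ n / (n:ℝ) ^ 2 : ℝ) : ℂ) := by push_cast; rfl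
  rw [this, Complex.ofReal_re]

lemma neg_pi_sq_div_twelve_le_re_dilog {z : ℂ} (hz : ‖z‖ < 1) :
    -Real.pi ^ 2 / 12 ≤ (dilog z).re := by
  refine le_of_tendsto tendsto_re_dilog_neg ?_
  filter_upwards [Ico_mem_nhdsLT hz] with ρ hρ
  exact re_dilog_neg_le hρ.1 hρ.2

lemma re_dilog_le_pi_sq_div_six {z : ℂ} (hz : ‖z‖ < 1) :
    (dilog z).re ≤ Real.pi ^ 2 / 6 := by
  refine hasSum_le (fun n => ?_) (Complex.hasSum_re (hasSum_dilog hz)) hasSum_zeta_two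
  refine (Complex.re_le_norm _).trans ?_
  rw [norm_div, norm_pow, norm_pow, Complex.norm_natCast]
  exact div_le_div_of_nonneg_right (pow_le_one₀ (norm_nonneg z) hz.le) (by positivity)

lemma log_norm_one_sub_mul_exp (s θ : ℝ) :
    Real.log ‖1 - (s:ℂ) * Complex.exp (Complex.I * (θ:ℂ))‖ =
      1 / 2 * Real.log (1 - 2 * s * Real.cos θ + s ^ 2) := by
  have hsq : ‖1 - (s:ℂ) * Complex.exp (Complex.I * (θ:ℂ))‖ ^ 2 =
      1 - 2 * s * Real.cos θ + s ^ 2 := by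
    rw [mul_comm Complex.I, Complex.sq_norm, Complex.normSq_apply]
    simp only [Complex.sub_re, Complex.sub_im, Complex.one_re, Complex.one_im,
      Complex.re_ofReal_mul, Complex.im_ofReal_mul, Complex.exp_ofReal_mul_I_re,
      Complex.exp_ofReal_mul_I_im]
    nlinarith [Real.sin_sq_add_cos_sq θ]
  rw [← hsq, Real.log_pow]
  push_cast
  ring

lemma re_dilog_mul_exp {r : ℝ} (θ : ℝ) (hr0 : 0 < r) (hr1 : r < 1) :
    (dilog ((r:ℂ) * Complex.exp (Complex.I * (θ:ℂ)))).re =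
      -(1/2) * ∫ s in (0:ℝ)..r, Real.log (1 - 2 * s * Real.cos θ + s ^ 2) / s := by
  have hn : ‖(r:ℂ) * Complex.exp (Complex.I * (θ:ℂ))‖ < 1 := by
    rw [norm_mul, Complex.norm_exp_I_mul_ofReal, mul_one, Complex.norm_real,
      Real.norm_of_nonneg hr0.le]
    exact hr1
  have hsub := intervalIntegral.smul_integral_comp_mul_left (a := 0) (b := 1)
    (fun s => Real.log (1 - 2 * s * Real.cos θ + s ^ 2) / s) r
  rw [mul_zero, mul_one, smul_eq_mul] at hsub
  rw [re_dilog_eq_neg_integral hn, ← hsub, ← mul_assoc, ← intervalIntegral.integral_const_mul,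
    ← intervalIntegral.integral_neg]
  refine intervalIntegral.integral_congr fun t _ => ?_
  have h := log_norm_one_sub_mul_exp (r * t) θ
  rw [Complex.ofReal_mul, mul_comm (r:ℂ), mul_assoc] at h
  simp only [h]
  rcases eq_or_ne t 0 with rfl | ht
  · simp
  · field_simp

/-- `-π²/12 ≤ Re Li₂(re^{√-1θ}) ≤ π²/6` for `0 < r < 1`, `0 < θ < 2π`,
together with the real-integral expression of the real part. -/
theorem stmt16 (r θ : ℝ) (hr0 : 0 < r) (hr1 : r < 1) (hθ0 : 0 < θ) (hθ1 : θ < 2*Real.pi) :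
    -Real.pi^2/12 ≤ (dilog ((r:ℂ) * Complex.exp (Complex.I*(θ:ℂ)))).re ∧
    (dilog ((r:ℂ) * Complex.exp (Complex.I*(θ:ℂ)))).re ≤ Real.pi^2/6 ∧
    (dilog ((r:ℂ) * Complex.exp (Complex.I*(θ:ℂ)))).re =
      -(1/2) * ∫ s in (0:ℝ)..r, Real.log (1 - 2*s*Real.cos θ + s^2)/s := by
  have hn : ‖(r:ℂ) * Complex.exp (Complex.I * (θ:ℂ))‖ < 1 := by
    rw [norm_mul, Complex.norm_exp_I_mul_ofReal, mul_one, Complex.norm_real,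
      Real.norm_of_nonneg hr0.le]
    exact hr1
  exact ⟨neg_pi_sq_div_twelve_le_re_dilog hn, re_dilog_le_pi_sq_div_six hn,
    re_dilog_mul_exp θ hr0 hr1⟩
end

section
/- For every real r with 0 < r < 1: (i) if 0 < θ ≤ π then 0 ≤ Im Li₂(r e^{√-1 θ}) ≤ Im Li₂(e^{√-1 π/3}); and (ii) if π < θ < 2π then Im Li₂(r e^{√-1 θ}) ≥ -Im Li₂(e^{√-1 π/3}). Here Im Li₂(e^{√-1 π/3}) = -∫₀^1 arg(1 - s e^{√-1 π/3})/s ds > 0. -/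
open Complex MeasureTheory Filter Topology Finset

theorem one_sub_ofReal_mul_mem_slitPlane {z : ℂ} (hz : 1 - z ∈ slitPlane) {t : ℝ}
    (ht : t ∈ Set.Icc (0:ℝ) 1) : 1 - (t:ℂ) * z ∈ slitPlane := by
  have h := starConvex_one_slitPlane hz (sub_nonneg.2 ht.2) ht.1 (sub_add_cancel 1 t)
  convert h using 1
  simp only [Complex.real_smul]
  push_cast
  ring

theorem one_sub_mem_slitPlane_of_norm_lt_one {z : ℂ} (hz : ‖z‖ < 1) : 1 - z ∈ slitPlane := by
  rw [sub_eq_add_neg]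
  exact mem_slitPlane_of_norm_lt_one (by rwa [norm_neg])

theorem intervalIntegrable_dilog_integrand {z : ℂ} (hz : 1 - z ∈ slitPlane) :
    IntervalIntegrable (fun t : ℝ => Complex.log (1 - (t:ℂ) * z) / (t:ℂ)) volume 0 1 := by
  set f : ℝ → ℂ := fun t => Complex.log (1 - (t:ℂ) * z) with hf
  set s : Set ℝ := {t | 1 - (t:ℂ) * z ∈ slitPlane} with hs
  have hlin : Continuous fun t : ℝ => 1 - (t:ℂ) * z := by fun_prop
  have hs0 : (0:ℝ) ∈ s := by simp [hs]
  have hnhds : s ∈ 𝓝 (0:ℝ) := (isOpen_slitPlane.preimage hlin).mem_nhds hs0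
  have hcont : ContinuousOn f s := hlin.continuousOn.clog fun t ht => ht
  have hdiff : DifferentiableAt ℝ f 0 := by
    have h1 : HasDerivAt (fun t : ℝ => 1 - (t:ℂ) * z) (-(1 * z)) 0 :=
      ((Complex.ofRealCLM.hasDerivAt (x := (0:ℝ))).mul_const z).const_sub 1
    exact (h1.clog_real hs0).differentiableAt
  have hds : ContinuousOn (dslope f 0) (Set.uIcc 0 1) := by
    refine ((continuousOn_dslope hnhds).2 ⟨hcont, hdiff⟩).mono fun t ht => ?_
    rw [Set.uIcc_of_le zero_le_one] at ht
    exact one_sub_ofReal_mul_mem_slitPlane hz ht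
  refine hds.intervalIntegrable.congr_uIoo fun t ht => ?_
  rw [Set.uIoo_of_le zero_le_one] at ht
  rw [dslope_of_ne _ ht.1.ne', slope_def_module]
  simp [hf, div_eq_inv_mul]

theorem log_one_sub_div_im (z : ℂ) (t : ℝ) :
    (Complex.log (1 - (t:ℂ) * z) / (t:ℂ)).im = Complex.arg (1 - (t:ℂ) * z) / t := by
  rw [Complex.div_ofReal_im, Complex.log_im]

theorem intervalIntegrable_arg_one_sub_div {z : ℂ} (hz : 1 - z ∈ slitPlane) :
    IntervalIntegrable (fun t : ℝ => Complex.arg (1 - (t:ℂ) * z) / t) volume 0 1 := by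
  have h := intervalIntegrable_dilog_integrand hz
  rw [intervalIntegrable_iff] at h ⊢
  unfold IntegrableOn at h ⊢
  simpa only [RCLike.im_eq_complex_im, log_one_sub_div_im] using h.im

theorem dilog_im {z : ℂ} (hz : 1 - z ∈ slitPlane) :
    (dilog z).im = -∫ t in (0:ℝ)..1, Complex.arg (1 - (t:ℂ) * z) / t := by
  have h := Complex.imCLM.intervalIntegral_comp_comm (intervalIntegrable_dilog_integrand hz)
  simp only [Complex.imCLM_apply, log_one_sub_div_im] at h
  rw [dilog, Complex.neg_im, h]

theorem dilog_ofReal_mul_im {z : ℂ} (hz : 1 - z ∈ slitPlane) {r : ℝ} (hr : r ∈ Set.Icc (0:ℝ) 1) :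
    (dilog ((r:ℂ) * z)).im = -∫ s in (0:ℝ)..r, Complex.arg (1 - (s:ℂ) * z) / s := by
  rw [dilog_im (one_sub_ofReal_mul_mem_slitPlane hz hr)]
  have h := intervalIntegral.smul_integral_comp_mul_left
    (fun s : ℝ => Complex.arg (1 - (s:ℂ) * z) / s) r (a := 0) (b := 1)
  rw [mul_zero, mul_one, ← intervalIntegral.integral_smul] at h
  rw [← h]
  congr 1
  refine intervalIntegral.integral_congr fun t _ => ?_
  rcases eq_or_ne r 0 with rfl | hr0
  · simp
  · rcases eq_or_ne t 0 with rfl | ht0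
    · simp
    · have he : (t:ℂ) * ((r:ℂ) * z) = ((r * t : ℝ) : ℂ) * z := by push_cast; ring
      simp only [he, smul_eq_mul]
      field_simp

theorem arg_one_sub_ofReal_mul_nonpos {z : ℂ} (hz : 1 - z ∈ slitPlane) (hi : 0 ≤ z.im) {t : ℝ}
    (ht : t ∈ Set.Icc (0:ℝ) 1) : Complex.arg (1 - (t:ℂ) * z) ≤ 0 := by
  have him : (1 - (t:ℂ) * z).im = -(t * z.im) := by simp
  have hle : (1 - (t:ℂ) * z).im ≤ 0 := by
    rw [him]
    exact neg_nonpos.2 (mul_nonneg ht.1 hi)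
  rcases hle.lt_or_eq with h | h
  · exact (Complex.arg_neg_iff.2 h).le
  · refine (Complex.arg_eq_zero_iff.2 ⟨?_, h⟩).le
    rcases Complex.mem_slitPlane_iff.1 (one_sub_ofReal_mul_mem_slitPlane hz ht) with h' | h'
    · exact h'.le
    · exact absurd h h'

theorem dilog_im_nonneg {z : ℂ} (hz : 1 - z ∈ slitPlane) (hi : 0 ≤ z.im) : 0 ≤ (dilog z).im := by
  rw [dilog_im hz, ← intervalIntegral.integral_neg]
  refine intervalIntegral.integral_nonneg zero_le_one fun t ht => ?_
  exact neg_nonneg.2 (div_nonpos_of_nonpos_of_nonneg (arg_one_sub_ofReal_mul_nonpos hz hi ht) ht.1)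

theorem dilog_im_pos {z : ℂ} (hi : 0 < z.im) : 0 < (dilog z).im := by
  have hz : 1 - z ∈ slitPlane := Complex.mem_slitPlane_iff.2 (Or.inr (by simpa using hi.ne'))
  rw [dilog_im hz, ← intervalIntegral.integral_neg]
  refine intervalIntegral.intervalIntegral_pos_of_pos_on
    (intervalIntegrable_arg_one_sub_div hz).neg (fun t ht => ?_) zero_lt_one
  have him : (1 - (t:ℂ) * z).im < 0 := by simpa using mul_pos ht.1 hi
  exact neg_pos.2 (div_neg_of_neg_of_pos (Complex.arg_neg_iff.2 him) ht.1)

theorem dilog_ofReal_mul_im_le {z : ℂ} (hz : 1 - z ∈ slitPlane) (hi : 0 ≤ z.im) {r : ℝ}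
    (hr : r ∈ Set.Icc (0:ℝ) 1) : (dilog ((r:ℂ) * z)).im ≤ (dilog z).im := by
  rw [dilog_ofReal_mul_im hz hr, dilog_im hz, ← intervalIntegral.integral_neg,
    ← intervalIntegral.integral_neg]
  refine intervalIntegral.integral_mono_interval le_rfl hr.1 hr.2 ?_
    (intervalIntegrable_arg_one_sub_div hz).neg
  refine (ae_restrict_iff' measurableSet_Ioc).2 (Eventually.of_forall fun t ht => ?_)
  exact neg_nonneg.2 (div_nonpos_of_nonpos_of_nonneg
    (arg_one_sub_ofReal_mul_nonpos hz hi ⟨ht.1.le, ht.2⟩) ht.1.le)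

theorem dilog_conj_im {z : ℂ} (hz : 1 - z ∈ slitPlane) :
    (dilog ((starRingEnd ℂ) z)).im = -(dilog z).im := by
  have hz' : 1 - (starRingEnd ℂ) z ∈ slitPlane := by
    simpa [Complex.mem_slitPlane_iff] using hz
  rw [dilog_im hz, dilog_im hz']
  congr 1
  rw [← intervalIntegral.integral_neg]
  refine intervalIntegral.integral_congr fun t ht => ?_
  rw [Set.uIcc_of_le zero_le_one] at ht
  have he : 1 - (t:ℂ) * (starRingEnd ℂ) z = (starRingEnd ℂ) (1 - (t:ℂ) * z) := by simp
  have harg := Complex.slitPlane_arg_ne_pi (one_sub_ofReal_mul_mem_slitPlane hz ht)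
  simp only [he, Complex.arg_conj, if_neg harg, neg_div]

theorem hasDerivAt_dilog_s17 {z : ℂ} (hz : ‖z‖ < 1) :
    HasDerivAt dilog (∫ t in (0:ℝ)..1, (1 - (t:ℂ) * z)⁻¹) z := by
  obtain ⟨R, hzR, hR1⟩ := exists_between hz
  have hnorm : ∀ t ∈ Set.uIoc (0:ℝ) 1, ∀ w ∈ Metric.ball (0:ℂ) R, ‖(t:ℂ) * w‖ ≤ R := by
    intro t ht w hw
    rw [Set.uIoc_of_le zero_le_one] at ht
    rw [mem_ball_zero_iff] at hw
    rw [norm_mul, Complex.norm_real, Real.norm_of_nonneg ht.1.le]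
    nlinarith [norm_nonneg w, ht.1, ht.2]
  have hmem : ∀ t ∈ Set.uIoc (0:ℝ) 1, ∀ w ∈ Metric.ball (0:ℂ) R, 1 - (t:ℂ) * w ∈ slitPlane :=
    fun t ht w hw => one_sub_mem_slitPlane_of_norm_lt_one ((hnorm t ht w hw).trans_lt hR1)
  have hball : Metric.ball (0:ℂ) R ∈ 𝓝 z :=
    Metric.isOpen_ball.mem_nhds (mem_ball_zero_iff.2 hzR)
  have hint : ∀ w ∈ Metric.ball (0:ℂ) R,
      IntervalIntegrable (fun t : ℝ => Complex.log (1 - (t:ℂ) * w) / (t:ℂ)) volume 0 1 :=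
    fun w hw => intervalIntegrable_dilog_integrand
      (one_sub_mem_slitPlane_of_norm_lt_one ((mem_ball_zero_iff.1 hw).trans hR1))
  have key := intervalIntegral.hasDerivAt_integral_of_dominated_loc_of_deriv_le
    (μ := volume) (a := 0) (b := 1) (x₀ := z)
    (F := fun w (t : ℝ) => Complex.log (1 - (t:ℂ) * w) / (t:ℂ))
    (F' := fun w (t : ℝ) => -(1 - (t:ℂ) * w)⁻¹) (bound := fun _ => (1 - R)⁻¹) hball
    (by
      filter_upwards [hball] with w hw
      exact (intervalIntegrable_iff.1 (hint w hw)).aestronglyMeasurable)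
    (hint z (mem_ball_zero_iff.2 hzR))
    (Measurable.aestronglyMeasurable (by fun_prop))
    (Eventually.of_forall fun t ht w hw => ?_) intervalIntegrable_const
    (Eventually.of_forall fun t ht w hw => ?_)
  · have h := key.2.neg
    rw [← intervalIntegral.integral_neg] at h
    simp only [neg_neg] at h
    exact h
  · rw [norm_neg, norm_inv]
    have h1 := norm_sub_norm_le (1:ℂ) ((t:ℂ) * w)
    rw [norm_one] at h1
    exact inv_anti₀ (sub_pos.2 hR1) (by linarith [hnorm t ht w hw])
  · have ht0 : (t:ℂ) ≠ 0 := by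
      rw [Set.uIoc_of_le zero_le_one] at ht
      exact_mod_cast ht.1.ne'
    have h1 : HasDerivAt (fun w : ℂ => 1 - (t:ℂ) * w) (-((t:ℂ) * 1)) w :=
      ((hasDerivAt_id w).const_mul (t:ℂ)).const_sub 1
    refine ((h1.clog (hmem t ht w hw)).div_const (t:ℂ)).congr_deriv ?_
    have := slitPlane_ne_zero (hmem t ht w hw)
    field_simp

theorem mul_integral_inv_one_sub {z : ℂ} (hz : 1 - z ∈ slitPlane) :
    z * ∫ t in (0:ℝ)..1, (1 - (t:ℂ) * z)⁻¹ = -Complex.log (1 - z) := by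
  have hmem : ∀ t ∈ Set.uIcc (0:ℝ) 1, 1 - (t:ℂ) * z ∈ slitPlane := fun t ht =>
    one_sub_ofReal_mul_mem_slitPlane hz (by rwa [Set.uIcc_of_le zero_le_one] at ht)
  have hderiv : ∀ t ∈ Set.uIcc (0:ℝ) 1,
      HasDerivAt (fun t : ℝ => -Complex.log (1 - (t:ℂ) * z)) (z * (1 - (t:ℂ) * z)⁻¹) t := by
    intro t ht
    have h1 : HasDerivAt (fun t : ℝ => 1 - (t:ℂ) * z) (-(1 * z)) t :=
      ((Complex.ofRealCLM.hasDerivAt (x := t)).mul_const z).const_sub 1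
    exact (h1.clog_real (hmem t ht)).neg.congr_deriv (by ring)
  have hcont : ContinuousOn (fun t : ℝ => z * (1 - (t:ℂ) * z)⁻¹) (Set.uIcc 0 1) :=
    continuousOn_const.mul (ContinuousOn.inv₀ (by fun_prop) fun t ht =>
      slitPlane_ne_zero (hmem t ht))
  rw [← intervalIntegral.integral_const_mul,
    intervalIntegral.integral_eq_sub_of_hasDerivAt hderiv hcont.intervalIntegrable]
  simp

theorem norm_ofReal_mul_exp_I_mul {r : ℝ} (hr : 0 ≤ r) (θ : ℝ) :
    ‖(r:ℂ) * Complex.exp (Complex.I * (θ:ℂ))‖ = r := by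
  rw [norm_mul, mul_comm Complex.I, Complex.norm_exp_ofReal_mul_I, Complex.norm_real,
    Real.norm_of_nonneg hr, mul_one]

theorem ofReal_mul_exp_I_mul_im (r θ : ℝ) :
    ((r:ℂ) * Complex.exp (Complex.I * (θ:ℂ))).im = r * Real.sin θ := by
  rw [mul_comm Complex.I, Complex.im_ofReal_mul, Complex.exp_ofReal_mul_I_im]

theorem sq_norm_one_sub_ofReal_mul_exp (r θ : ℝ) :
    ‖1 - (r:ℂ) * Complex.exp (Complex.I * (θ:ℂ))‖ ^ 2 = 1 - 2 * r * Real.cos θ + r ^ 2 := by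
  rw [Complex.sq_norm, Complex.normSq_apply, mul_comm Complex.I]
  simp only [Complex.sub_re, Complex.sub_im, Complex.one_re, Complex.one_im,
    Complex.re_ofReal_mul, Complex.im_ofReal_mul, Complex.exp_ofReal_mul_I_re,
    Complex.exp_ofReal_mul_I_im]
  linear_combination r ^ 2 * Real.sin_sq_add_cos_sq θ

theorem hasDerivAt_dilog_circle_im {r : ℝ} (hr0 : 0 ≤ r) (hr1 : r < 1) (θ : ℝ) :
    HasDerivAt (fun θ : ℝ => (dilog ((r:ℂ) * Complex.exp (Complex.I * (θ:ℂ)))).im)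
      (-Real.log ‖1 - (r:ℂ) * Complex.exp (Complex.I * (θ:ℂ))‖) θ := by
  set z := (r:ℂ) * Complex.exp (Complex.I * (θ:ℂ)) with hz
  have hz1 : ‖z‖ < 1 := (norm_ofReal_mul_exp_I_mul hr0 θ).trans_lt hr1
  have hcirc : HasDerivAt (fun θ : ℝ => (r:ℂ) * Complex.exp (Complex.I * (θ:ℂ)))
      (Complex.I * z) θ := by
    have h := (((Complex.ofRealCLM.hasDerivAt (x := θ)).const_mul Complex.I).cexp).const_mul (r:ℂ)
    refine h.congr_deriv ?_
    simp only [hz, Complex.ofRealCLM_apply, Complex.ofReal_one, mul_one]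
    ring
  have h := (HasDerivAt.comp θ (hasDerivAt_dilog_s17 hz1) hcirc)
  have h2 := Complex.imCLM.hasFDerivAt.comp_hasDerivAt θ h
  refine h2.congr_deriv ?_
  rw [mul_left_comm, mul_comm _ z,
    mul_integral_inv_one_sub (one_sub_mem_slitPlane_of_norm_lt_one hz1)]
  simp [Complex.log_re]

theorem dilog_circle_im_le_add {r θ : ℝ} (hr0 : 0 < r) (hr1 : r < 1) (hθ0 : 0 ≤ θ)
    (hθ1 : θ ≤ Real.pi) :
    (dilog ((r:ℂ) * Complex.exp (Complex.I * (θ:ℂ)))).im ≤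
      (dilog ((r:ℂ) * Complex.exp (Complex.I * ((Real.pi / 3 : ℝ):ℂ)))).im -
        Real.log r * Real.pi / 2 := by
  set h : ℝ → ℝ := fun θ => (dilog ((r:ℂ) * Complex.exp (Complex.I * (θ:ℂ)))).im with hh
  have hd : ∀ x : ℝ, HasDerivAt h (-Real.log ‖1 - (r:ℂ) * Complex.exp (Complex.I * (x:ℂ))‖) x :=
    hasDerivAt_dilog_circle_im hr0.le hr1
  have hdiff : Differentiable ℝ h := fun x => (hd x).differentiableAt
  have hlog : Real.log r ≤ 0 := Real.log_nonpos hr0.le hr1.le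
  have hpi := Real.pi_pos
  change h θ ≤ h (Real.pi / 3) - _
  rcases le_total θ (Real.pi / 3) with hle | hle
  · have := (convex_Icc 0 (Real.pi / 3)).mul_sub_le_image_sub_of_le_deriv (f := h) (C := 0)
      hdiff.continuous.continuousOn hdiff.differentiableOn (fun x hx => ?_) θ ⟨hθ0, hle⟩
      (Real.pi / 3) ⟨by positivity, le_rfl⟩ hle
    · nlinarith
    · rw [interior_Icc] at hx
      rw [(hd x).deriv, neg_nonneg]
      refine Real.log_nonpos (norm_nonneg _) ((sq_le_one_iff₀ (norm_nonneg _)).1 ?_)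
      have hcos : 1 / 2 ≤ Real.cos x := by
        rw [← Real.cos_pi_div_three]
        exact Real.cos_le_cos_of_nonneg_of_le_pi hx.1.le (by linarith) hx.2.le
      rw [sq_norm_one_sub_ofReal_mul_exp]
      nlinarith
  · have := (convex_Icc (Real.pi / 3) Real.pi).image_sub_le_mul_sub_of_deriv_le (f := h)
      (C := -(Real.log r / 2)) hdiff.continuous.continuousOn hdiff.differentiableOn
      (fun x hx => ?_) (Real.pi / 3) ⟨le_rfl, by linarith⟩ θ ⟨hle, hθ1⟩ hle
    · nlinarith
    · rw [interior_Icc] at hx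
      have hcos : Real.cos x ≤ 1 / 2 := by
        rw [← Real.cos_pi_div_three]
        exact Real.cos_le_cos_of_nonneg_of_le_pi (by positivity) hx.2.le hx.1.le
      have hsq : r ≤ ‖1 - (r:ℂ) * Complex.exp (Complex.I * (x:ℂ))‖ ^ 2 := by
        rw [sq_norm_one_sub_ofReal_mul_exp]
        nlinarith [sq_nonneg (1 - r)]
      have hl := Real.log_le_log hr0 hsq
      rw [Real.log_pow] at hl
      push_cast at hl
      rw [(hd x).deriv]
      linarith

theorem dilog_circle_im_le {r θ : ℝ} (hr0 : 0 < r) (hr1 : r < 1) (hθ0 : 0 ≤ θ)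
    (hθ1 : θ ≤ Real.pi) :
    (dilog ((r:ℂ) * Complex.exp (Complex.I * (θ:ℂ)))).im ≤
      (dilog (Complex.exp (Complex.I * (Real.pi:ℂ) / 3))).im := by
  set w := Complex.exp (Complex.I * (Real.pi:ℂ) / 3) with hw
  have hw' : Complex.exp (Complex.I * ((Real.pi / 3 : ℝ):ℂ)) = w := by
    rw [hw]
    push_cast
    ring_nf
  have hwim : 0 < w.im := by
    have h := ofReal_mul_exp_I_mul_im 1 (Real.pi / 3)
    rw [hw', Complex.ofReal_one, one_mul, one_mul, Real.sin_pi_div_three] at h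
    rw [h]
    positivity
  have hwslit : 1 - w ∈ slitPlane := Complex.mem_slitPlane_iff.2 (Or.inr (by simpa using hwim.ne'))
  have hbound : ∀ ρ ∈ Set.Ioo r 1, (dilog ((r:ℂ) * Complex.exp (Complex.I * (θ:ℂ)))).im ≤
      (dilog w).im - Real.log ρ * Real.pi / 2 := by
    rintro ρ ⟨hrρ, hρ1⟩
    have hρ0 : 0 < ρ := hr0.trans hrρ
    set z := (ρ:ℂ) * Complex.exp (Complex.I * (θ:ℂ)) with hz
    have hzslit : 1 - z ∈ slitPlane := one_sub_mem_slitPlane_of_norm_lt_one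
      ((norm_ofReal_mul_exp_I_mul hρ0.le θ).trans_lt hρ1)
    have hzim : 0 ≤ z.im := by
      rw [hz, ofReal_mul_exp_I_mul_im]
      exact mul_nonneg hρ0.le (Real.sin_nonneg_of_nonneg_of_le_pi hθ0 hθ1)
    have he : (r:ℂ) * Complex.exp (Complex.I * (θ:ℂ)) = ((r / ρ : ℝ):ℂ) * z := by
      have : (ρ:ℂ) ≠ 0 := by exact_mod_cast hρ0.ne'
      rw [hz]
      push_cast
      field_simp
    have h1 := dilog_ofReal_mul_im_le hzslit hzim (r := r / ρ)
      ⟨by positivity, (div_le_one hρ0).2 hrρ.le⟩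
    have h2 := dilog_circle_im_le_add hρ0 hρ1 hθ0 hθ1
    rw [hw'] at h2
    have h3 := dilog_ofReal_mul_im_le hwslit hwim.le (r := ρ) ⟨hρ0.le, hρ1.le⟩
    rw [he]
    linarith
  have hlim : Tendsto (fun ρ : ℝ => (dilog w).im - Real.log ρ * Real.pi / 2) (𝓝[<] 1)
      (𝓝 ((dilog w).im - Real.log 1 * Real.pi / 2)) := by
    refine Tendsto.mono_left ?_ nhdsWithin_le_nhds
    exact (((Real.continuousAt_log one_ne_zero).tendsto.mul_const _).div_const _).const_sub _
  rw [Real.log_one, zero_mul, zero_div, sub_zero] at hlim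
  refine ge_of_tendsto hlim ?_
  filter_upwards [Ioo_mem_nhdsLT hr1] with ρ hρ using hbound ρ hρ

/-- bounds on `Im Li₂(re^{√-1θ})` for `0 < r < 1`, plus the integral
formula for, and positivity of, `Im Li₂(e^{√-1π/3})`. -/
theorem stmt17 (r : ℝ) (hr0 : 0 < r) (hr1 : r < 1) :
    (∀ θ : ℝ, 0 < θ → θ ≤ Real.pi →
      0 ≤ (dilog ((r:ℂ) * Complex.exp (Complex.I*(θ:ℂ)))).im ∧
      (dilog ((r:ℂ) * Complex.exp (Complex.I*(θ:ℂ)))).im ≤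
        (dilog (Complex.exp (Complex.I*(Real.pi:ℂ)/3))).im) ∧
    (∀ θ : ℝ, Real.pi < θ → θ < 2*Real.pi →
      -(dilog (Complex.exp (Complex.I*(Real.pi:ℂ)/3))).im ≤
        (dilog ((r:ℂ) * Complex.exp (Complex.I*(θ:ℂ)))).im) ∧
    (dilog (Complex.exp (Complex.I*(Real.pi:ℂ)/3))).im =
      -∫ s in (0:ℝ)..1, Complex.arg (1 - (s:ℂ)*Complex.exp (Complex.I*(Real.pi:ℂ)/3))/s ∧
    0 < (dilog (Complex.exp (Complex.I*(Real.pi:ℂ)/3))).im := by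
  
  have hwim : 0 < (Complex.exp (Complex.I*(Real.pi:ℂ)/3)).im := by
    have he : Complex.I * (Real.pi:ℂ) / 3 = ((Real.pi / 3 : ℝ):ℂ) * Complex.I := by
      push_cast
      ring
    rw [he, Complex.exp_ofReal_mul_I_im, Real.sin_pi_div_three]
    positivity
  have hslit : ∀ θ : ℝ, 1 - (r:ℂ) * Complex.exp (Complex.I*(θ:ℂ)) ∈ slitPlane := fun θ =>
    one_sub_mem_slitPlane_of_norm_lt_one ((norm_ofReal_mul_exp_I_mul hr0.le θ).trans_lt hr1)
  refine ⟨fun θ h0 h1 => ⟨dilog_im_nonneg (hslit θ) ?_, dilog_circle_im_le hr0 hr1 h0.le h1⟩,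
    fun θ h0 h1 => ?_, dilog_im ?_, dilog_im_pos hwim⟩
  · rw [ofReal_mul_exp_I_mul_im]
    exact mul_nonneg hr0.le (Real.sin_nonneg_of_nonneg_of_le_pi h0.le h1)
  · have hconj : (r:ℂ) * Complex.exp (Complex.I*(θ:ℂ)) =
        (starRingEnd ℂ) ((r:ℂ) * Complex.exp (Complex.I*((2 * Real.pi - θ : ℝ):ℂ))) := by
      rw [map_mul, Complex.conj_ofReal, ← Complex.exp_conj, map_mul, Complex.conj_I,
        Complex.conj_ofReal, ← Complex.exp_periodic.sub_eq]
      congr 2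
      push_cast
      ring
    rw [hconj, dilog_conj_im (hslit _)]
    exact neg_le_neg (dilog_circle_im_le hr0 hr1 (by linarith) (by linarith))
  · exact Complex.mem_slitPlane_iff.2 (Or.inr (by simpa using hwim.ne'))
end
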